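/- (Theorem 1, continuity) The distributional zeta-function Φ is continuous on the closed half-plane {s ∈ ℂ : Re(s) ≥ 0}. -/

import Mathlib

open MeasureTheory

/-- The field integrand of the zero-dimensional `φ⁴` model with source `h` is integrable. -/
lemma integrable_exp_quartic {a b : ℝ} (ha : 0 < a) (hb : 0 < b) (h : ℝ) :
    Integrable fun φ : ℝ => Real.exp (-(a / 2) * φ ^ 2 - (b / 24) * φ ^ 4 - h * φ) := by
  refine ((integrable_exp_neg_mul_sq (by positivity : 0 < a / 4)).const_mul
    (Real.exp (h ^ 2 / a))).mono' (by fun_prop) (Filter.Eventually.of_forall fun φ => ?_)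
  rw [Real.norm_eq_abs, Real.abs_exp, ← Real.exp_add, Real.exp_le_exp]
  have hsq : h ^ 2 / a + h * φ + a / 4 * φ ^ 2 = (h + a / 2 * φ) ^ 2 / a := by
    field_simp
    ring
  have hsq_nonneg : 0 ≤ (h + a / 2 * φ) ^ 2 / a := by positivity
  have hquartic : 0 ≤ b / 24 * φ ^ 4 := by positivity
  linarith

/-- The partition function of the zero-dimensional `φ⁴` model is bounded below uniformly in the
source `h`. -/
lemma exp_le_integral_exp_quartic {a b : ℝ} (ha : 0 < a) (hb : 0 < b) (h : ℝ) :
    Real.exp (-(a / 2 + b / 24)) ≤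
      ∫ φ : ℝ, Real.exp (-(a / 2) * φ ^ 2 - (b / 24) * φ ^ 4 - h * φ) := by
  have hint := integrable_exp_quartic ha hb h
  have key : ∀ c : ℝ, (∀ φ ∈ Set.Icc c (c + 1), |φ| ≤ 1 ∧ h * φ ≤ 0) →
      Real.exp (-(a / 2 + b / 24)) ≤
        ∫ φ : ℝ, Real.exp (-(a / 2) * φ ^ 2 - (b / 24) * φ ^ 4 - h * φ) := by
    intro c hc
    calc Real.exp (-(a / 2 + b / 24))
        = ∫ _ in Set.Icc c (c + 1), Real.exp (-(a / 2 + b / 24)) := by simp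
      _ ≤ ∫ φ in Set.Icc c (c + 1),
            Real.exp (-(a / 2) * φ ^ 2 - (b / 24) * φ ^ 4 - h * φ) := by
          refine setIntegral_mono_on (by simp) hint.integrableOn measurableSet_Icc
            fun φ hφ => Real.exp_le_exp.2 ?_
          obtain ⟨habs, hneg⟩ := hc φ hφ
          have h2 : φ ^ 2 ≤ 1 := (sq_le_one_iff_abs_le_one φ).2 habs
          have h4 : φ ^ 4 ≤ 1 := by nlinarith [sq_nonneg φ]
          nlinarith
      _ ≤ _ := setIntegral_le_integral hint (Filter.Eventually.of_forall fun φ => by positivity)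
  rcases le_total h 0 with hh | hh
  · refine key 0 fun φ hφ => ⟨abs_le.2 ⟨?_, ?_⟩, mul_nonpos_of_nonpos_of_nonneg hh ?_⟩ <;>
      linarith [hφ.1, hφ.2]
  · refine key (-1) fun φ hφ => ⟨abs_le.2 ⟨?_, ?_⟩, mul_nonpos_of_nonneg_of_nonpos hh ?_⟩ <;>
      linarith [hφ.1, hφ.2]

/-- The Laplace transform of a measurable function bounded below, with respect to a finite
measure, is continuous on the closed right half-plane. -/
lemma continuousOn_integral_cexp_neg_mul {α : Type*} [MeasurableSpace α] (μ : Measure α)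
    [IsFiniteMeasure μ] {L : α → ℝ} (hL : Measurable L) {C : ℝ} (hC : ∀ x, -C ≤ L x) :
    ContinuousOn (fun s : ℂ => ∫ x, Complex.exp (-s * (L x : ℂ)) ∂μ) {s : ℂ | 0 ≤ s.re} := by
  intro s₀ _
  refine continuousWithinAt_of_dominated (bound := fun _ => Real.exp ((s₀.re + 1) * |C|))
    (Filter.Eventually.of_forall fun s => ?_) ?_ (integrable_const _)
    (Filter.Eventually.of_forall fun x => ?_)
  · exact (by fun_prop : Measurable fun x => Complex.exp (-s * (L x : ℂ))).aestronglyMeasurable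
  · have hlt : ∀ᶠ s in nhdsWithin s₀ {s : ℂ | 0 ≤ s.re}, s.re < s₀.re + 1 :=
      (Complex.continuous_re.continuousWithinAt).eventually_lt continuousWithinAt_const (by simp)
    filter_upwards [hlt, self_mem_nhdsWithin] with s hs hs0
    refine Filter.Eventually.of_forall fun x => ?_
    rw [Complex.norm_exp, Real.exp_le_exp, Complex.re_mul_ofReal, Complex.neg_re]
    have hs0 : 0 ≤ s.re := hs0
    calc -s.re * L x ≤ s.re * |C| := by nlinarith [hC x, le_abs_self C]
      _ ≤ (s₀.re + 1) * |C| := mul_le_mul_of_nonneg_right hs.le (abs_nonneg C)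
  · exact (by fun_prop : Continuous fun s : ℂ => Complex.exp (-s * (L x : ℂ))).continuousWithinAt



/-- Theorem 1, continuity: The distributional zeta-function
`Φ(s) = ∫ Z(h)^{-s} dμ(h)`, where `Z(h)^{-s} = exp(-s·ln Z(h))`, is continuous on the
closed half-plane `{s ∈ ℂ : Re(s) ≥ 0}`. -/
theorem stmt_4 (m0sq lam : ℝ) (hm : 0 < m0sq) (hlam : 0 < lam)
    (Z : ℝ → ℝ)
    (hZ : ∀ h : ℝ, Z h =
      ∫ φ : ℝ, Real.exp (-(m0sq / 2) * φ ^ 2 - (lam / 24) * φ ^ 4 - h * φ))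
    (μ : Measure ℝ) [IsProbabilityMeasure μ]
    (Φ : ℂ → ℂ)
    (hΦ : ∀ s : ℂ, Φ s = ∫ h : ℝ, Complex.exp (-s * (Real.log (Z h) : ℂ)) ∂μ) :
    ContinuousOn Φ {s : ℂ | 0 ≤ s.re} := by
  have hZm : Measurable Z := by
    have hcont : Continuous fun p : ℝ × ℝ =>
        Real.exp (-(m0sq / 2) * p.2 ^ 2 - (lam / 24) * p.2 ^ 4 - p.1 * p.2) := by fun_prop
    rw [funext hZ]
    exact (hcont.stronglyMeasurable.integral_prod_right').measurable
  have hlog : ∀ h, -(m0sq / 2 + lam / 24) ≤ Real.log (Z h) := fun h => by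
    have hle := exp_le_integral_exp_quartic hm hlam h
    rw [← hZ h] at hle
    exact (Real.le_log_iff_exp_le ((Real.exp_pos _).trans_le hle)).2 hle
  rw [funext hΦ]
  exact continuousOn_integral_cexp_neg_mul μ (Real.measurable_log.comp hZm) hlog
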